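/- Let p ∈ (0,1) and let T_tgt ≥ 1, δ ≥ 0, n_r ≥ 0, and i be integers with i > 1 + δ + n_r. Then Σ_{j=T_tgt−δ}^{T_tgt+δ} Σ_{m=0}^{n_r} C(i−1−δ, m) · p^{1+m} · (1−p)^{i−j+T_tgt−1−m} = D · (1 − (1−p)^{1+2δ}), where D = Σ_{m=0}^{n_r} C(i−1−δ, m) · p^m · (1−p)^{i−1−δ−m}. -/

import Mathlib

theorem Int.sum_Icc_sub_add_eq_sum_range {M : Type*} [AddCommMonoid M] (f : ℤ → M)
    (t : ℤ) (d : ℕ) :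
    ∑ j ∈ Finset.Icc (t - d) (t + d), f j = ∑ k ∈ Finset.range (1 + 2 * d), f (t + d - k) := by
  refine Finset.sum_bij' (fun j _ => (t + d - j).toNat) (fun k _ => t + d - k) ?_ ?_ ?_ ?_ ?_
  · intro j hj
    simp only [Finset.mem_Icc, Finset.mem_range] at hj ⊢
    omega
  · intro k hk
    simp only [Finset.mem_Icc, Finset.mem_range] at hk ⊢
    omega
  · intro j hj
    simp only [Finset.mem_Icc] at hj
    omega
  · intro k _
    omega
  · intro j hj
    simp only [Finset.mem_Icc] at hj
    congr 1
    omega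


/-- For `p ∈ (0,1)` and integers `T_tgt ≥ 1`, `δ ≥ 0`, `n_r ≥ 0`,
`i > 1 + δ + n_r`:
`Σ_{j=T_tgt−δ}^{T_tgt+δ} Σ_{m=0}^{n_r} C(i−1−δ, m) p^(1+m) (1−p)^(i−j+T_tgt−1−m)
  = D (1 − (1−p)^(1+2δ))` where `D = Σ_{m=0}^{n_r} C(i−1−δ, m) p^m (1−p)^(i−1−δ−m)`. -/
theorem repeat_reward_high_state (p : ℝ) (hp : p ∈ Set.Ioo (0 : ℝ) 1)
    (Ttgt δ nr i : ℕ) (hT : 1 ≤ Ttgt) (hi : 1 + δ + nr < i) :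
    ∑ j ∈ Finset.Icc ((Ttgt : ℤ) - δ) ((Ttgt : ℤ) + δ),
        ∑ m ∈ Finset.range (nr + 1),
          ((i - 1 - δ).choose m : ℝ) * p ^ (1 + m) * (1 - p) ^ ((i : ℤ) - j + Ttgt - 1 - m) =
      (∑ m ∈ Finset.range (nr + 1),
          ((i - 1 - δ).choose m : ℝ) * p ^ m * (1 - p) ^ (i - 1 - δ - m)) *
        (1 - (1 - p) ^ (1 + 2 * δ)) := by
  have hgeom : 1 - (1 - p) ^ (1 + 2 * δ) =
      ∑ k ∈ Finset.range (1 + 2 * δ), p * (1 - p) ^ k := by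
    rw [← Finset.mul_sum, ← mul_neg_geom_sum, sub_sub_cancel]
  rw [Int.sum_Icc_sub_add_eq_sum_range, hgeom, Finset.mul_sum]
  refine Finset.sum_congr rfl fun k _ => ?_
  rw [Finset.sum_mul]
  refine Finset.sum_congr rfl fun m hm => ?_
  have hm' := Finset.mem_range.mp hm
  have hexp : (i : ℤ) - (Ttgt + δ - k) + Ttgt - 1 - m = ((i - 1 - δ - m + k : ℕ) : ℤ) := by
    omega
  rw [hexp, zpow_natCast]
  ring
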